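/- arXiv:1111.4629 — 2 statements merged into one kernel-verified Lean document; each statement's English description precedes it below -/
import Mathlib

section
/- Let X and Y be bounded subsets of ℂ such that the topological boundary (frontier) of Y is contained in X. Then the closure of Y is contained in fill(X). -/
/-- The *filling* of a set `X ⊆ ℂ`: the union of `X` with all bounded connected
components of `ℂ \ X`. -/
def fill (X : Set ℂ) : Set ℂ :=
  {z : ℂ | Bornology.IsBounded (connectedComponentIn Xᶜ z)}

/-- If `X` and `Y` are bounded subsets of `ℂ` and the frontier of `Y` is contained
in `X`, then the closure of `Y` is contained in `fill X`. -/
theorem closure_subset_fill_of_frontier_subset (X Y : Set ℂ)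
    (hX : Bornology.IsBounded X) (hY : Bornology.IsBounded Y)
    (h : frontier Y ⊆ X) : closure Y ⊆ fill X := by
  intro z hz
  change Bornology.IsBounded (connectedComponentIn Xᶜ z)
  by_cases hzX : z ∈ X
  · rw [connectedComponentIn_eq_empty (by simpa using hzX)]
    exact Bornology.isBounded_empty
  · refine hY.closure.subset ?_
    have hzC : z ∈ connectedComponentIn Xᶜ z := mem_connectedComponentIn hzX
    have hsub := connectedComponentIn_subset Xᶜ z
    have hcov : connectedComponentIn Xᶜ z ⊆ interior Y ∪ (closure Y)ᶜ := by
      intro w hw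
      by_contra hcon
      simp only [Set.mem_union, Set.mem_compl_iff, not_or, not_not] at hcon
      exact hsub hw (h ⟨hcon.2, hcon.1⟩)
    have hzi : z ∈ interior Y := by
      by_contra hcon
      exact hzX (h ⟨hz, hcon⟩)
    have hdisj : Disjoint (interior Y) (closure Y)ᶜ :=
      Set.disjoint_compl_right_iff_subset.mpr (interior_subset.trans subset_closure)
    exact (isPreconnected_connectedComponentIn.subset_left_of_subset_union isOpen_interior
      isClosed_closure.isOpen_compl hdisj hcov ⟨z, hzC, hzi⟩).trans
      (interior_subset.trans subset_closure)
end

section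
/- Let K be a nonempty compact connected full subset of ℂ (full meaning that ℂ ∖ K is connected, equivalently fill(K) = K). Then K has a neighborhood basis of connected and simply connected open sets: for every open set U ⊆ ℂ with K ⊆ U there exists an open set V with K ⊆ V ⊆ U such that V is connected and simply connected. -/
section Helpers
open Set

theorem homotopic_cancel {Y : Type} [TopologicalSpace Y] {x y z : Y} (p q : Path x y)
    (h : Path y z) (h3 : (p.trans h).Homotopic (q.trans h)) : p.Homotopic q := by
  have h4 := h3.hcomp (Path.Homotopic.refl h.symm)
  rw [← Path.Homotopic.Quotient.eq] at h4 ⊢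
  simpa using h4

theorem sc_of_dominated {X Y : Type} [TopologicalSpace X] [TopologicalSpace Y]
    [SimplyConnectedSpace X] [Nonempty Y] (i : C(Y, X)) (f : C(X, Y))
    (H : ContinuousMap.Homotopy (ContinuousMap.id Y) (f.comp i)) : SimplyConnectedSpace Y := by
  rw [simply_connected_iff_paths_homotopic']
  constructor
  · refine ⟨‹_›, fun x y => ?_⟩
    have h1 : ∀ z : Y, Joined z (f (i z)) := fun z => by
      exact ⟨(H.evalAt z).cast (by simp) (by simp)⟩
    have h2 : Joined (f (i x)) (f (i y)) :=
      (PathConnectedSpace.joined (i x) (i y)).map f.continuous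
    exact (h1 x).trans (h2.trans (h1 y).symm)
  · intro x y p q
    have hpq : (p.map i.continuous).Homotopic (q.map i.continuous) :=
      SimplyConnectedSpace.paths_homotopic _ _
    have h2 : (p.map (f.comp i).continuous).Homotopic (q.map (f.comp i).continuous) := hpq.map f
    have key : ∀ r : Path x y, (r.trans (H.evalAt y)).Homotopic
      ((H.evalAt x).trans (r.map (f.comp i).continuous)) := fun r =>
        Path.Homotopic.map_trans_evalAt H r
    have h3 : (p.trans (H.evalAt y)).Homotopic (q.trans (H.evalAt y)) :=
      (key p).trans (((Path.Homotopic.refl _).hcomp h2).trans (key q).symm)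
    exact homotopic_cancel p q _ h3

theorem sc_of_push {A C : Set ℂ} (hA : SimplyConnectedSpace A) (hCA : C ⊆ A) (hne : C.Nonempty)
    (f : ℂ → ℂ) (hf : ContinuousOn f A) (hm : MapsTo f A C)
    (hs : ∀ z ∈ C, ∀ t : ℝ, 0 ≤ t → t ≤ 1 → z + t * (f z - z) ∈ C) : SimplyConnectedSpace C := by
  have : Nonempty C := hne.to_subtype
  have hfc : Continuous (fun z : A => f z) := continuousOn_iff_continuous_domRestrict.mp hf
  let i : C(C, A) := ⟨fun z => ⟨z, hCA z.2⟩, by fun_prop⟩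
  let F : C(A, C) := ⟨fun z => ⟨f z, hm z.2⟩, hfc.subtype_mk _⟩
  have hfi : Continuous (fun z : C => f z) := hfc.comp i.continuous
  refine sc_of_dominated i F
    { toFun := fun x => ⟨x.2 + (x.1 : ℝ) * (f x.2 - x.2), hs _ x.2.2 _ x.1.2.1 x.1.2.2⟩
      continuous_toFun := ?_
      map_zero_left := ?_
      map_one_left := ?_ }
  · have : Continuous (fun x : unitInterval × C => f x.2) := hfi.comp continuous_snd
    refine Continuous.subtype_mk ?_ _
    have h2 : Continuous (fun x : unitInterval × C => (x.2 : ℂ)) :=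
      continuous_subtype_val.comp continuous_snd
    have h3 : Continuous (fun x : unitInterval × C => ((x.1 : ℝ) : ℂ)) :=
      Complex.continuous_ofReal.comp (continuous_subtype_val.comp continuous_fst)
    exact h2.add (h3.mul (this.sub h2))
  · intro x; ext; simp
  · intro x; ext; simp [F, i]

/-- slit lemma -/
theorem sc_slit {A : Set ℂ} (hAo : IsOpen A) (hA : SimplyConnectedSpace A) (h0 : (0 : ℂ) ∉ A)
    (h1 : ∀ x : ℝ, 0 < x → x ≤ 1 → (x : ℂ) ∈ A) :
    SimplyConnectedSpace ↥(A \ segment ℝ (0 : ℂ) 1) := by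
  set E : Set ℂ := segment ℝ (0 : ℂ) 1 with hE
  have hEmem : ∀ z : ℂ, z ∈ E ↔ z.im = 0 ∧ 0 ≤ z.re ∧ z.re ≤ 1 := by
    intro z
    rw [hE, segment_eq_image]
    constructor
    · rintro ⟨t, ht, rfl⟩
      simpa using ht
    · rintro ⟨h, h', h''⟩
      exact ⟨z.re, ⟨h', h''⟩, by apply Complex.ext <;> simp [h]⟩
  have hEc : IsClosed E := by
    have : E = {z : ℂ | z.im = 0 ∧ 0 ≤ z.re ∧ z.re ≤ 1} := by ext z; exact hEmem z
    rw [this]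
    exact (isClosed_eq Complex.continuous_im continuous_const).inter
      ((isClosed_le continuous_const Complex.continuous_re).inter
        (isClosed_le Complex.continuous_re continuous_const))
  obtain ⟨ε, hε, hball⟩ := Metric.isOpen_iff.mp hAo 1 (by simpa using h1 1 one_pos le_rfl)
  set e := ε / 2 with he
  have hepos : 0 < e := by positivity
  have h1' : ∀ x : ℝ, 0 < x → x ≤ 1 + e → (x : ℂ) ∈ A := by
    intro x hx hx'
    rcases le_or_gt x 1 with h | h
    · exact h1 x hx h
    · apply hball
      rw [Metric.mem_ball, Complex.dist_eq, ← Complex.ofReal_one, ← Complex.ofReal_sub,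
        Complex.norm_real, Real.norm_eq_abs, abs_of_pos (by linarith)]
      linarith
  let W : Set ℂ := {z | ∀ s ∈ Icc (0:ℝ) 1, z + ((s * max 0 (1 + e - z.re) : ℝ) : ℂ) ∈ A}
  have hWo : IsOpen W := by
    rw [isOpen_iff_eventually]
    intro z hz
    apply isCompact_Icc.eventually_forall_of_forall_eventually
    intro s hs
    have hc : Continuous (fun q : ℂ × ℝ => q.1 + ((q.2 * max 0 (1 + e - q.1.re) : ℝ) : ℂ)) := by
      fun_prop
    exact hc.continuousAt.eventually (hAo.mem_nhds (hz s hs))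
  have hEW : ∀ z ∈ E, z ∈ A → z ∈ W := by
    intro z hz hzA s hs
    obtain ⟨a, b, c⟩ := (hEmem z).1 hz
    have hre : z = (z.re : ℂ) := by apply Complex.ext <;> simp [a]
    have hpos : 0 < z.re := by
      rcases b.lt_or_eq with h | h
      · exact h
      · exact absurd (by rw [hre, ← h] at hzA; simpa using hzA) h0
    rw [max_eq_right (by linarith), hre, ← Complex.ofReal_add]
    apply h1'
    · simp only [Complex.ofReal_re]
      have := hs.1
      have : 0 ≤ s * (1 + e - z.re) := mul_nonneg hs.1 (by linarith)
      linarith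
    · simp only [Complex.ofReal_re]
      have : s * (1 + e - z.re) ≤ 1 * (1 + e - z.re) :=
        mul_le_mul_of_nonneg_right hs.2 (by linarith)
      linarith
  have h0W : (0:ℂ) ∉ W := fun h => h0 (by simpa using h 0 (by simp))
  have hWne : (Wᶜ).Nonempty := ⟨0, h0W⟩
  have hEne : E.Nonempty := ⟨0, by rw [hEmem]; simp⟩
  let a : ℂ → ℝ := fun z => Metric.infDist z Wᶜ
  let b : ℂ → ℝ := fun z => Metric.infDist z E
  have ha : Continuous a := Metric.continuous_infDist_pt _
  have hb : Continuous b := Metric.continuous_infDist_pt _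
  have ha0 : ∀ z, 0 ≤ a z := fun z => Metric.infDist_nonneg
  have hb0 : ∀ z, 0 ≤ b z := fun z => Metric.infDist_nonneg
  have haW : ∀ z, z ∈ W ↔ 0 < a z := by
    intro z
    rw [← hWo.isClosed_compl.notMem_iff_infDist_pos hWne]; simp
  have hbE : ∀ z, z ∉ E ↔ 0 < b z := fun z => hEc.notMem_iff_infDist_pos hEne
  have hab : ∀ z ∈ A, a z + b z ≠ 0 := by
    intro z hz
    by_cases h : z ∈ E
    · have := (haW z).1 (hEW z h hz); have := hb0 z; linarith
    · have := (hbE z).1 h; have := ha0 z; linarith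
  let ψ : ℂ → ℝ := fun z => a z / (a z + b z)
  have hψ0 : ∀ z, 0 ≤ ψ z := fun z => div_nonneg (ha0 z) (add_nonneg (ha0 z) (hb0 z))
  have hψ1 : ∀ z, ψ z ≤ 1 := fun z =>
    div_le_one_of_le₀ (by linarith [hb0 z]) (add_nonneg (ha0 z) (hb0 z))
  have hψW : ∀ z, z ∉ W → ψ z = 0 := by
    intro z hz
    have : a z = 0 := le_antisymm (not_lt.1 (fun h => hz ((haW z).2 h))) (ha0 z)
    simp [ψ, this]
  have hψE : ∀ z ∈ E, z ∈ A → ψ z = 1 := by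
    intro z hz hzA
    have hbz : b z = 0 := le_antisymm (not_lt.1 (fun h => (hbE z).2 h hz)) (hb0 z)
    have := hab z hzA
    simp only [ψ, hbz, add_zero] at *
    exact div_self this
  let f : ℂ → ℂ := fun z => z + ((ψ z * max 0 (1 + e - z.re) : ℝ) : ℂ)
  have hψc : ContinuousOn ψ A := ContinuousOn.div ha.continuousOn (by fun_prop) hab
  have hf : ContinuousOn f A := by
    have : ContinuousOn (fun z : ℂ => ((ψ z * max 0 (1 + e - z.re) : ℝ) : ℂ)) A :=
      Complex.continuous_ofReal.comp_continuousOn (hψc.mul (by fun_prop))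
    exact continuousOn_id.add this
  -- motion stays in the slit domain
  have hmove : ∀ z ∈ A \ E, ∀ t : ℝ, 0 ≤ t → t ≤ 1 → z + t * (f z - z) ∈ A \ E := by
    intro z hz t ht ht'
    have e1 : z + t * (f z - z) = z + (((t * ψ z) * max 0 (1 + e - z.re) : ℝ) : ℂ) := by
      simp only [f]; push_cast; ring
    by_cases hzW : z ∈ W
    · have hA1 : z + t * (f z - z) ∈ A := by
        rw [e1]
        exact hzW _ ⟨mul_nonneg ht (hψ0 z), mul_le_one₀ ht' (hψ0 z) (hψ1 z)⟩
      refine ⟨hA1, fun hmem => ?_⟩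
      rw [e1, hEmem] at hmem
      obtain ⟨him, hre0, hre1⟩ := hmem
      simp only [Complex.add_im, Complex.ofReal_im, add_zero, Complex.add_re,
        Complex.ofReal_re] at him hre0 hre1
      have hnn : 0 ≤ t * ψ z * max 0 (1 + e - z.re) :=
        mul_nonneg (mul_nonneg ht (hψ0 z)) (le_max_left _ _)
      have hneg : z.re < 0 := by
        by_contra hcon
        exact hz.2 ((hEmem z).2 ⟨him, not_lt.1 hcon, by linarith⟩)
      apply h0
      have hp : 0 < 1 + e - z.re := by linarith
      have := hzW (-z.re / (1 + e - z.re))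
        ⟨div_nonneg (by linarith) hp.le, (div_le_one hp).2 (by linarith)⟩
      rw [max_eq_right hp.le, div_mul_cancel₀ _ hp.ne'] at this
      convert this using 1
      apply Complex.ext <;> simp [him]
    · rw [e1, hψW z hzW]; simpa using hz
  have hmaps : MapsTo f A (A \ E) := by
    intro z hz
    by_cases hzE : z ∈ E
    · obtain ⟨p, q, r⟩ := (hEmem z).1 hzE
      have hfz : f z = ((1 + e : ℝ) : ℂ) := by
        simp only [f, hψE z hzE hz]
        rw [max_eq_right (by linarith)]
        apply Complex.ext <;> simp [p]
      rw [hfz]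
      refine ⟨h1' _ (by linarith) le_rfl, fun h => ?_⟩
      have := ((hEmem _).1 h).2.2
      simp at this; linarith
    · simpa using hmove z ⟨hz, hzE⟩ 1 zero_le_one le_rfl
  have hne : (A \ E).Nonempty := ⟨f 1, hmaps (by simpa using h1 1 one_pos le_rfl)⟩
  exact sc_of_push hA sdiff_subset hne f hf hmaps hmove

theorem mem_seg01 (z : ℂ) : z ∈ segment ℝ (0 : ℂ) 1 ↔ z.im = 0 ∧ 0 ≤ z.re ∧ z.re ≤ 1 := by
  rw [segment_eq_image]
  constructor
  · rintro ⟨t, ht, rfl⟩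
    simpa using ht
  · rintro ⟨h, h', h''⟩
    exact ⟨z.re, ⟨h', h''⟩, by apply Complex.ext <;> simp [h]⟩

theorem int_const {C : Set ℂ} (hC : IsPreconnected C) (u : ℂ → ℝ) (hu : ContinuousOn u C)
    (hintg : ∀ z ∈ C, ∃ n : ℤ, u z = n) {z w : ℂ} (hz : z ∈ C) (hw : w ∈ C) : u z = u w := by
  have key : ∀ z ∈ C, ∀ w ∈ C, ¬ (u z < u w) := by
    intro z hz w hw hlt
    obtain ⟨m, hm⟩ := hintg z hz
    obtain ⟨n, hn⟩ := hintg w hw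
    have hmn : (m : ℝ) + 1 ≤ n := by
      rw [hm, hn] at hlt
      exact_mod_cast hlt
    obtain ⟨v, hv, hv'⟩ := hC.intermediate_value hz hw hu
      (show (m : ℝ) + 1/2 ∈ Icc (u z) (u w) from ⟨by rw [hm]; linarith, by rw [hn]; linarith⟩)
    obtain ⟨k, hk⟩ := hintg v hv
    rw [hk] at hv'
    have h1 : (2 * k : ℤ) = 2 * m + 1 := by
      have : (2 * k : ℝ) = 2 * m + 1 := by linarith
      exact_mod_cast this
    omega
  exact le_antisymm (not_lt.1 (key w hw z hz)) (not_lt.1 (key z hz w hw))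

open Complex Filter Topology in
/-- the two sides of a crosscut of a simply connected domain lie in different components -/
theorem cross_sep {A C : Set ℂ} (hAo : IsOpen A) (hA : SimplyConnectedSpace A)
    (h0 : (0 : ℂ) ∉ A) (h1 : (1 : ℂ) ∉ A) (hhalf : (1/2 : ℂ) ∈ A)
    (hCA : C ⊆ A \ segment ℝ (0 : ℂ) 1) (hC : IsPreconnected C)
    {ε : ℝ} (hε : 0 < ε)
    (hup : ∀ η : ℝ, 0 < η → η < ε → (1/2 : ℂ) + η * I ∈ C)
    (hdn : ∀ η : ℝ, 0 < η → η < ε → (1/2 : ℂ) - η * I ∈ C) : False := by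
  let g : ℂ → ℂ := fun z => z / (z - 1)
  have hsub : ∀ z ∈ A, z - 1 ≠ 0 := fun z hz h => h1 (by rwa [← sub_eq_zero.1 h])
  have hz0 : ∀ z ∈ A, z ≠ 0 := fun z hz h => h0 (h ▸ hz)
  have hg : ContinuousOn g A := ContinuousOn.div continuousOn_id (by fun_prop) hsub
  have hgA : (0:ℂ) ∉ g '' A := by
    rintro ⟨z, hz, hgz⟩
    exact (div_ne_zero (hz0 z hz) (hsub z hz)) hgz
  obtain ⟨F, hF, hexp⟩ := exists_continuousOn_eqOn_exp_comp (U := A) hA hAo hg hgA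
  have hslit : ∀ z ∈ C, g z ∈ slitPlane := by
    intro z hz
    have hzA := (hCA hz).1
    have hzE := (hCA hz).2
    rw [mem_slitPlane_iff]
    by_contra hcon
    push Not at hcon
    obtain ⟨hre, him⟩ := hcon
    apply hzE
    rw [mem_seg01]
    -- g z = -c , c ≥ 0
    have hgr : g z = ((g z).re : ℂ) := by apply Complex.ext <;> simp [him]
    set c := (g z).re
    have hzc : z = c * (z - 1) := by
      rw [← hgr]; exact (div_mul_cancel₀ _ (hsub z hzA)).symm
    have e1 := congrArg Complex.re hzc
    have e2 := congrArg Complex.im hzc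
    simp at e1 e2
    refine ⟨?_, ?_, ?_⟩
    · have : z.im * (1 - c) = 0 := by linarith
      rcases mul_eq_zero.1 this with h | h
      · exact h
      · linarith
    · have : z.re * (1 - c) = -c := by linarith
      nlinarith
    · have : z.re * (1 - c) = -c := by linarith
      nlinarith
  let u : ℂ → ℝ := fun z => (F z - log (g z)).im / (2 * Real.pi)
  have hCA' : C ⊆ A := fun z hz => (hCA hz).1
  have hu : ContinuousOn u C := by
    have hl : ContinuousOn (fun z => log (g z)) C := (hg.mono hCA').clog hslit
    exact (Complex.continuous_im.comp_continuousOn ((hF.mono hCA').sub hl)).div_const _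
  have hintg : ∀ z ∈ C, ∃ n : ℤ, u z = n := by
    intro z hz
    have h2 : exp (F z) = exp (log (g z)) := by
      rw [exp_log (slitPlane_ne_zero (hslit z hz))]; exact hexp (hCA' hz)
    obtain ⟨n, hn⟩ := exp_eq_exp_iff_exists_int.1 h2
    refine ⟨n, ?_⟩
    simp only [u, hn]
    have := Real.pi_pos
    simp
  -- limits
  have hgh : g (1/2) = -1 := by simp only [g]; norm_num
  have hgc : ContinuousAt g (1/2) := hg.continuousAt (hAo.mem_nhds hhalf)
  have hFc : ContinuousAt F (1/2) := hF.continuousAt (hAo.mem_nhds hhalf)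
  have hup0 : Tendsto (fun η : ℝ => (1/2 : ℂ) + η * I) (𝓝[>] 0) (𝓝 (1/2)) := by
    have : Continuous (fun η : ℝ => (1/2 : ℂ) + η * I) := by fun_prop
    have := this.tendsto 0
    simp only [ofReal_zero, zero_mul, add_zero] at this
    exact this.mono_left nhdsWithin_le_nhds
  have hdn0 : Tendsto (fun η : ℝ => (1/2 : ℂ) - η * I) (𝓝[>] 0) (𝓝 (1/2)) := by
    have : Continuous (fun η : ℝ => (1/2 : ℂ) - η * I) := by fun_prop
    have := this.tendsto 0
    simp only [ofReal_zero, zero_mul, sub_zero] at this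
    exact this.mono_left nhdsWithin_le_nhds
  have hgu : Tendsto (fun η : ℝ => g ((1/2 : ℂ) + η * I)) (𝓝[>] 0) (𝓝[{z : ℂ | z.im < 0}] (-1)) := by
    refine tendsto_nhdsWithin_iff.2 ⟨hgh ▸ hgc.tendsto.comp hup0, ?_⟩
    filter_upwards [self_mem_nhdsWithin] with η hη
    have hη : 0 < η := hη
    simp only [g, div_im, normSq_apply]
    simp
    rw [← sub_neg, ← sub_div]
    apply div_neg_of_neg_of_pos <;> nlinarith
  have hgd : Tendsto (fun η : ℝ => g ((1/2 : ℂ) - η * I)) (𝓝[>] 0) (𝓝[{z : ℂ | 0 ≤ z.im}] (-1)) := by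
    refine tendsto_nhdsWithin_iff.2 ⟨hgh ▸ hgc.tendsto.comp hdn0, ?_⟩
    filter_upwards [self_mem_nhdsWithin] with η hη
    have hη : 0 < η := hη
    simp only [g, div_im, normSq_apply]
    simp
    rw [← sub_nonneg, ← sub_div]
    apply div_nonneg <;> nlinarith
  have Lu := (tendsto_log_nhdsWithin_im_neg_of_re_neg_of_im_zero (z := -1) (by simp) (by simp)).comp hgu
  have Ld := (tendsto_log_nhdsWithin_im_nonneg_of_re_neg_of_im_zero (z := -1) (by simp) (by simp)).comp hgd
  have Uu := (Complex.continuous_im.tendsto _).comp ((hFc.tendsto.comp hup0).sub Lu)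
  have Ud := (Complex.continuous_im.tendsto _).comp ((hFc.tendsto.comp hdn0).sub Ld)
  have heq : ∀ᶠ η : ℝ in 𝓝[>] 0, (F ((1/2 : ℂ) + η * I) - log (g ((1/2 : ℂ) + η * I))).im
      = (F ((1/2 : ℂ) - η * I) - log (g ((1/2 : ℂ) - η * I))).im := by
    filter_upwards [Ioo_mem_nhdsGT hε] with η hη
    have := int_const hC u hu hintg (hup η hη.1 hη.2) (hdn η hη.1 hη.2)
    have hp := Real.pi_pos
    simp only [u] at this
    exact (div_left_inj' (by positivity)).1 this
  have hfin := tendsto_nhds_unique_of_eventuallyEq Uu Ud heq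
  have hp := Real.pi_pos
  simp at hfin
  linarith

open Complex in
theorem sc_cross {A C : Set ℂ} (hAo : IsOpen A) (hA : SimplyConnectedSpace A)
    (h0 : (0 : ℂ) ∉ A) (h1 : (1 : ℂ) ∉ A)
    (hσ : ∀ x : ℝ, 0 < x → x < 1 → (x : ℂ) ∈ A)
    (hCA : C ⊆ A \ segment ℝ (0 : ℂ) 1) (hC : IsPreconnected C) (hCne : C.Nonempty)
    (hmax : ∀ S : Set ℂ, IsPreconnected S → S ⊆ A \ segment ℝ (0 : ℂ) 1 → (S ∩ C).Nonempty →
      S ⊆ C) : SimplyConnectedSpace C := by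
  set E : Set ℂ := segment ℝ (0 : ℂ) 1 with hE
  have hEmem : ∀ z : ℂ, z ∈ E ↔ z.im = 0 ∧ 0 ≤ z.re ∧ z.re ≤ 1 := mem_seg01
  have hEc : IsClosed E := by
    have : E = {z : ℂ | z.im = 0 ∧ 0 ≤ z.re ∧ z.re ≤ 1} := by ext z; exact hEmem z
    rw [this]
    exact (isClosed_eq Complex.continuous_im continuous_const).inter
      ((isClosed_le continuous_const Complex.continuous_re).inter
        (isClosed_le Complex.continuous_re continuous_const))
  have hAE : IsOpen (A \ E) := hAo.sdiff hEc
  have hCA' : C ⊆ A := fun z hz => (hCA hz).1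
  have hCo : IsOpen C := by
    rw [Metric.isOpen_iff]
    intro z hz
    obtain ⟨ε, hε, hb⟩ := Metric.isOpen_iff.1 hAE z (hCA hz)
    exact ⟨ε, hε, hmax _ (convex_ball z ε).isPreconnected hb ⟨z, Metric.mem_ball_self hε, hz⟩⟩
  have hEA : ∀ z ∈ E, z ∈ A → z = (z.re : ℂ) ∧ 0 < z.re ∧ z.re < 1 := by
    intro z hz hzA
    obtain ⟨a, b, c⟩ := (hEmem z).1 hz
    have hre : z = (z.re : ℂ) := by apply Complex.ext <;> simp [a]
    refine ⟨hre, lt_of_le_of_ne b ?_, lt_of_le_of_ne c ?_⟩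
    · intro h; apply h0; rw [← h] at hre; rw [hre] at hzA; simpa using hzA
    · intro h; apply h1; rw [h] at hre; rw [hre] at hzA; simpa using hzA
  let d : ℂ → ℝ := fun z => Metric.infDist z Aᶜ
  have hAcne : (Aᶜ).Nonempty := ⟨0, h0⟩
  have hd : Continuous d := Metric.continuous_infDist_pt _
  have hd0 : ∀ z, 0 ≤ d z := fun z => Metric.infDist_nonneg
  have hdpos : ∀ z ∈ A, 0 < d z := by
    intro z hz
    exact (hAo.isClosed_compl.notMem_iff_infDist_pos hAcne).1 (by simpa using hz)
  have hdball : ∀ z w, dist w z < d z → w ∈ A := by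
    intro z w hw
    by_contra hcon
    have : d z ≤ dist z w := Metric.infDist_le_dist_of_mem hcon
    rw [dist_comm] at this; linarith
  have hdlip : ∀ z w, d z ≤ d w + dist z w := fun z w => Metric.infDist_le_infDist_add_dist
  have hd_0 : ∀ x : ℝ, 0 < x → x < 1 → d x ≤ x := by
    intro x hx _
    have : d x ≤ dist (x : ℂ) 0 := Metric.infDist_le_dist_of_mem h0
    rwa [dist_zero_right, Complex.norm_real, Real.norm_eq_abs, abs_of_pos hx] at this
  have hd_1 : ∀ x : ℝ, 0 < x → x < 1 → d x ≤ 1 - x := by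
    intro x _ hx
    have : d x ≤ dist (x : ℂ) 1 := Metric.infDist_le_dist_of_mem h1
    rwa [dist_comm, Complex.dist_eq, ← Complex.ofReal_one, ← Complex.ofReal_sub, Complex.norm_real,
      Real.norm_eq_abs, abs_of_pos (by linarith)] at this
  -- half balls
  let Hb : ℝ → ℝ → Set ℂ := fun sg s => Metric.ball (s : ℂ) (d s) ∩ {z | 0 < sg * z.im}
  have hHb_pre : ∀ sg s, IsPreconnected (Hb sg s) := by
    intro sg s
    apply Convex.isPreconnected
    apply (convex_ball _ _).inter
    have hlin : IsLinearMap ℝ (fun z : ℂ => sg * z.im) :=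
      ⟨fun x y => by rw [Complex.add_im, mul_add], fun c x => by
        rw [Complex.smul_im, smul_eq_mul, smul_eq_mul]; ring⟩
    exact (convex_Ioi (0:ℝ)).is_linear_preimage hlin
  have hHb_sub : ∀ sg s, Hb sg s ⊆ A \ E := by
    rintro sg s z ⟨hz, hz'⟩
    refine ⟨hdball s z hz, fun hzE => ?_⟩
    have : 0 < sg * z.im := hz'
    rw [((hEmem z).1 hzE).1] at this
    simp at this
  let T : ℝ → Prop := fun sg => ∃ s : ℝ, 0 < s ∧ s < 1 ∧ (Hb sg s ∩ C).Nonempty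
  have hnorm : ∀ (z : ℂ) (sg r : ℝ), (sg = 1 ∨ sg = -1) → 0 ≤ r →
      dist (z + ((sg * r : ℝ) : ℂ) * I) z = r := by
    intro z sg r hsg hr
    rw [Complex.dist_eq, add_sub_cancel_left, norm_mul, Complex.norm_I, mul_one, Complex.norm_real,
      Real.norm_eq_abs]
    rcases hsg with rfl | rfl <;> simp [abs_of_nonneg hr]
  have hsgsq : ∀ sg : ℝ, (sg = 1 ∨ sg = -1) → sg * sg = 1 := by
    rintro sg (rfl | rfl) <;> norm_num
  have hcurve : ∀ sg : ℝ, (sg = 1 ∨ sg = -1) → ∀ s : ℝ, 0 < s → s < 1 → ∀ r : ℝ, 0 < r → r < d s →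
      (s : ℂ) + ((sg * r : ℝ) : ℂ) * I ∈ Hb sg s := by
    intro sg hsg s hs hs' r hr hr'
    refine ⟨?_, ?_⟩
    · rw [Metric.mem_ball, hnorm _ _ _ hsg hr.le]; exact hr'
    · show 0 < sg * _
      simp
      rw [← mul_assoc, hsgsq sg hsg]; simpa using hr
  have hT : ∀ sg : ℝ, (sg = 1 ∨ sg = -1) → T sg → ∀ s : ℝ, 0 < s → s < 1 → Hb sg s ⊆ C := by
    rintro sg hsg ⟨s₀, hs₀, hs₀', hne⟩ s hs hs'
    have hsub0 := hmax _ (hHb_pre sg s₀) (hHb_sub sg s₀) hne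
    let γ : ℝ → ℂ := fun s => (s : ℂ) + ((sg * (d s / 2) : ℝ) : ℂ) * I
    have hγ : Continuous γ := by
      have : Continuous (fun s : ℝ => d s) := hd.comp Complex.continuous_ofReal
      fun_prop
    have hγH : ∀ s : ℝ, 0 < s → s < 1 → γ s ∈ Hb sg s := by
      intro s hs hs'
      have := hdpos _ (hσ s hs hs')
      exact hcurve sg hsg s hs hs' _ (by linarith) (by linarith)
    have hΓ : γ '' Ioo 0 1 ⊆ C := by
      apply hmax _ (isPreconnected_Ioo.image γ hγ.continuousOn)
      · rintro _ ⟨s, hs, rfl⟩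
        exact hHb_sub _ _ (hγH s hs.1 hs.2)
      · exact ⟨γ s₀, ⟨s₀, ⟨hs₀, hs₀'⟩, rfl⟩, hsub0 (hγH s₀ hs₀ hs₀')⟩
    exact hmax _ (hHb_pre sg s) (hHb_sub sg s) ⟨γ s, hγH s hs hs', hΓ ⟨s, ⟨hs, hs'⟩, rfl⟩⟩
  -- closure of C in A
  have hcl : ∀ z ∈ A, z ∈ closure C → z ∉ E → z ∈ C := by
    intro z hzA hz hzE
    obtain ⟨ε, hε, hb⟩ := Metric.isOpen_iff.1 hAE z ⟨hzA, hzE⟩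
    obtain ⟨w, hw, hwz⟩ := Metric.mem_closure_iff.1 hz ε hε
    exact hmax _ (convex_ball z ε).isPreconnected hb
      ⟨w, by rwa [Metric.mem_ball, dist_comm], hw⟩ (Metric.mem_ball_self hε)
  have hclE : ∀ z ∈ A, z ∈ closure C → z ∈ E → T 1 ∨ T (-1) := by
    intro z hzA hz hzE
    obtain ⟨hzr, hz0, hz1⟩ := hEA z hzE hzA
    obtain ⟨w, hw, hwz⟩ := Metric.mem_closure_iff.1 hz (d z) (hdpos z hzA)
    have hwb : w ∈ Metric.ball ((z.re : ℝ) : ℂ) (d (z.re : ℂ)) := by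
      rw [← hzr, Metric.mem_ball, dist_comm]; exact hwz
    rcases lt_trichotomy w.im 0 with h | h | h
    · right
      exact ⟨z.re, hz0, hz1, w, ⟨hwb, by show 0 < -1 * w.im; linarith⟩, hw⟩
    · exfalso
      apply (hCA hw).2
      have h3 : |w.re - z.re| ≤ dist w z := by
        rw [Complex.dist_eq, ← Complex.sub_re]; exact Complex.abs_re_le_norm _
      rw [dist_comm] at h3
      have h4 := hd_0 z.re hz0 hz1
      have h5 := hd_1 z.re hz0 hz1
      rw [← hzr] at h4 h5
      have := abs_lt.1 (h3.trans_lt hwz)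
      exact (hEmem w).2 ⟨h, by linarith, by linarith⟩
    · left
      exact ⟨z.re, hz0, hz1, w, ⟨hwb, by show 0 < 1 * w.im; linarith⟩, hw⟩
  have hhalf : ((1/2 : ℝ) : ℂ) ∈ A := hσ _ (by norm_num) (by norm_num)
  have hhalfE : ((1/2 : ℝ) : ℂ) ∈ E := by rw [hEmem]; norm_num
  have hApre : IsPreconnected A :=
    (IsSimplyConnected.isPathConnected (s := A) hA).isConnected.isPreconnected
  -- some side is touched
  have hsome : T 1 ∨ T (-1) := by
    by_contra hcon
    have : A ⊆ C := by
      apply hApre.subset_of_closure_inter_subset hCo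
      · obtain ⟨c, hc⟩ := hCne
        exact ⟨c, hCA' hc, hc⟩
      · rintro z ⟨hz, hzA⟩
        by_cases hzE : z ∈ E
        · exact absurd (hclE z hzA hz hzE) hcon
        · exact hcl z hzA hz hzE
    exact (hCA (this hhalf)).2 hhalfE
  -- not both
  have hnotboth : ¬ (T 1 ∧ T (-1)) := by
    rintro ⟨hT1, hT2⟩
    have hdh := hdpos _ hhalf
    have e1 : ((1/2 : ℝ) : ℂ) = 1/2 := by norm_num
    refine cross_sep hAo hA h0 h1 (by rw [← e1]; exact hhalf) hCA hC hdh ?_ ?_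
    · intro η hη hη'
      have := hT 1 (Or.inl rfl) hT1 (1/2) (by norm_num) (by norm_num)
        (hcurve 1 (Or.inl rfl) (1/2) (by norm_num) (by norm_num) η hη hη')
      rw [e1] at this
      simpa using this
    · intro η hη hη'
      have := hT (-1) (Or.inr rfl) hT2 (1/2) (by norm_num) (by norm_num)
        (hcurve (-1) (Or.inr rfl) (1/2) (by norm_num) (by norm_num) η hη hη')
      rw [e1] at this
      simpa [sub_eq_add_neg] using this
  obtain ⟨sg, hsg, hTs, hTn⟩ : ∃ sg : ℝ, (sg = 1 ∨ sg = -1) ∧ T sg ∧ ¬ T (-sg) := by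
    rcases hsome with h | h
    · exact ⟨1, Or.inl rfl, h, fun h' => hnotboth ⟨h, h'⟩⟩
    · exact ⟨-1, Or.inr rfl, h, fun h' => hnotboth ⟨by simpa using h', h⟩⟩
  let m : ℂ → ℝ := fun z => min (d z) (1/2)
  let τ : ℂ → ℂ := fun z => ((max (m z) (min z.re (1 - m z)) : ℝ) : ℂ)
  have hτc : Continuous τ := by fun_prop
  have hτr : ∀ z ∈ A, 0 < max (m z) (min z.re (1 - m z)) ∧ max (m z) (min z.re (1 - m z)) < 1 := by
    intro z hz
    have hm0 : 0 < m z := lt_min (hdpos z hz) (by norm_num)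
    have hm1 : m z ≤ 1/2 := min_le_right _ _
    refine ⟨lt_max_of_lt_left hm0, max_lt (by linarith) ?_⟩
    exact (min_le_right _ _).trans_lt (by linarith)
  have hτid : ∀ z ∈ A, z ∈ E → τ z = z := by
    intro z hzA hzE
    obtain ⟨hzr, hz0, hz1⟩ := hEA z hzE hzA
    have h4 := hd_0 z.re hz0 hz1
    have h5 := hd_1 z.re hz0 hz1
    rw [← hzr] at h4 h5
    have hm : m z ≤ d z := min_le_left _ _
    simp only [τ]
    rw [min_eq_left (by linarith), max_eq_right (by linarith), ← hzr]
  classical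
  let r : ℂ → ℂ := fun z => if z ∈ C then z else τ z
  have hrc : ContinuousOn r A := by
    apply ContinuousOn.if
    · rintro z ⟨hzA, hz⟩
      have hz1 : z ∈ closure C := frontier_subset_closure hz
      have hz2 : z ∉ C := by
        have := hz.2
        rwa [show {a | a ∈ C} = C from rfl, hCo.interior_eq] at this
      have hzE : z ∈ E := by
        by_contra h
        exact hz2 (hcl z hzA hz1 h)
      exact (hτid z hzA hzE).symm
    · exact continuousOn_id
    · exact hτc.continuousOn
  let g : ℂ → ℂ := fun z => z + ((sg * (d z / 3) : ℝ) : ℂ) * I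
  have hgc : Continuous g := by fun_prop
  have hpush : ∀ z ∈ C, ∀ t : ℝ, 0 ≤ t → t ≤ 1 → z + t * (g z - z) ∈ C := by
    intro z hz t ht ht'
    have hzA := hCA' hz
    have hdz := hdpos z hzA
    let γ : ℝ → ℂ := fun u => z + ((sg * u : ℝ) : ℂ) * I
    have hγ : Continuous γ := by fun_prop
    have hsub : γ '' Icc 0 (d z / 3) ⊆ C := by
      apply hmax _ (isPreconnected_Icc.image γ hγ.continuousOn)
      · rintro _ ⟨u, hu, rfl⟩
        have hdist : dist (γ u) z = u := hnorm z sg u hsg hu.1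
        have hγA : γ u ∈ A := hdball z _ (by rw [hdist]; linarith [hu.2])
        refine ⟨hγA, fun hγE => ?_⟩
        obtain ⟨hγr, hγ0, hγ1⟩ := hEA _ hγE hγA
        have him : z.im + sg * u = 0 := by
          have := ((hEmem _).1 hγE).1
          simpa [γ] using this
        have hu0 : 0 < u := by
          rcases hu.1.lt_or_eq with h | h
          · exact h
          · exfalso
            apply (hCA hz).2
            have : γ u = z := by simp [γ, ← h]
            rwa [this] at hγE
        apply hTn
        refine ⟨(γ u).re, hγ0, hγ1, z, ⟨?_, ?_⟩, hz⟩
        · rw [← hγr, Metric.mem_ball, dist_comm, hdist]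
          have := hdlip z (γ u)
          rw [dist_comm, hdist] at this
          linarith [hu.2]
        · show 0 < -sg * z.im
          have : z.im = -(sg * u) := by linarith
          rw [this]
          have := hsgsq sg hsg
          nlinarith
      · exact ⟨z, ⟨0, ⟨le_rfl, by linarith⟩, by simp [γ]⟩, hz⟩
    apply hsub
    refine ⟨t * (d z / 3), ⟨by positivity, ?_⟩, ?_⟩
    · nlinarith
    · simp only [γ, g]; push_cast; ring
  have hrC : ∀ z ∈ C, r z = z := fun z hz => if_pos hz
  refine sc_of_push hA hCA' hCne (g ∘ r) (hgc.comp_continuousOn hrc) ?_ ?_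
  · intro z hz
    by_cases hzC : z ∈ C
    · have := hpush z hzC 1 zero_le_one le_rfl
      simpa [hrC z hzC] using this
    · have hrz : r z = τ z := if_neg hzC
      obtain ⟨ha, hb⟩ := hτr z hz
      have hdp := hdpos _ (hσ _ ha hb)
      have := hT sg hsg hTs _ ha hb (hcurve sg hsg _ ha hb (d (τ z) / 3) (by
        simp only [τ]; linarith) (by simp only [τ]; linarith))
      simp only [Function.comp, hrz]
      exact this
  · intro z hz t ht ht'
    simp only [Function.comp, hrC z hz]
    exact hpush z hz t ht ht'

theorem sc_step01 {A C : Set ℂ} (hAo : IsOpen A) (hA : SimplyConnectedSpace A)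
    (h0 : (0 : ℂ) ∉ A)
    (hσ : ∀ x : ℝ, 0 < x → x < 1 → (x : ℂ) ∈ A)
    (hCA : C ⊆ A \ segment ℝ (0 : ℂ) 1) (hC : IsPreconnected C) (hCne : C.Nonempty)
    (hmax : ∀ S : Set ℂ, IsPreconnected S → S ⊆ A \ segment ℝ (0 : ℂ) 1 → (S ∩ C).Nonempty →
      S ⊆ C) : SimplyConnectedSpace C := by
  by_cases h1 : (1 : ℂ) ∈ A
  · have hsl := sc_slit hAo hA h0 (fun x hx hx' => by
      rcases hx'.lt_or_eq with h | h
      · exact hσ x hx h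
      · rw [h]; simpa using h1)
    have hpre := (IsSimplyConnected.isPathConnected hsl).isConnected.isPreconnected
    have : C = A \ segment ℝ (0 : ℂ) 1 := by
      apply hCA.antisymm
      apply hmax _ hpre subset_rfl
      obtain ⟨c, hc⟩ := hCne
      exact ⟨c, hCA hc, hc⟩
    rw [this]; exact hsl
  · exact sc_cross hAo hA h0 h1 hσ hCA hC hCne hmax

theorem sc_step {A : Set ℂ} (hAo : IsOpen A) (hA : SimplyConnectedSpace A) {p q x : ℂ}
    (hpq : p ≠ q) (hp : p ∉ A) (hσ : openSegment ℝ p q ⊆ A) (hx : x ∈ A \ segment ℝ p q) :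
    SimplyConnectedSpace (connectedComponentIn (A \ segment ℝ p q) x) := by
  have hne : q - p ≠ 0 := sub_ne_zero.2 hpq.symm
  let φ : ℂ ≃ₜ ℂ := (Homeomorph.mulRight₀ (q - p) hne).trans (Homeomorph.addLeft p)
  have hφ : ∀ z, φ z = p + z * (q - p) := fun z => rfl
  have hseg : ∀ z, φ z ∈ segment ℝ p q ↔ z ∈ segment ℝ (0:ℂ) 1 := by
    intro z
    rw [segment_eq_image', segment_eq_image']
    constructor
    · rintro ⟨t, ht, h⟩
      refine ⟨t, ht, ?_⟩
      rw [hφ] at h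
      simp only [Complex.real_smul] at h ⊢
      have := mul_right_cancel₀ hne (add_left_cancel h)
      simp [this]
    · rintro ⟨t, ht, rfl⟩
      exact ⟨t, ht, by simp [hφ]⟩
  set C := connectedComponentIn (A \ segment ℝ p q) x with hCdef
  have hCsub : C ⊆ A \ segment ℝ p q := connectedComponentIn_subset _ _
  have hCpre : IsPreconnected C := isPreconnected_connectedComponentIn
  have hxC : x ∈ C := mem_connectedComponentIn hx
  rw [← show IsSimplyConnected C ↔ SimplyConnectedSpace C from Iff.rfl,
    ← φ.isSimplyConnected_preimage]
  refine sc_step01 (A := φ ⁻¹' A) (hAo.preimage φ.continuous)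
    (φ.isSimplyConnected_preimage.2 hA) ?_ ?_ ?_ ?_ ?_ ?_
  · simpa [hφ] using hp
  · intro t ht ht'
    apply hσ
    rw [openSegment_eq_image']
    exact ⟨t, ⟨ht, ht'⟩, by simp [hφ]⟩
  · intro z hz
    have := hCsub hz
    exact ⟨this.1, fun h => this.2 ((hseg z).2 h)⟩
  · exact φ.isPreconnected_preimage.2 hCpre
  · exact ⟨φ.symm x, by simpa using hxC⟩
  · rintro S hS hSsub ⟨y, hyS, hyC⟩
    rw [← image_subset_iff]
    have h1 : φ '' S ⊆ A \ segment ℝ p q := by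
      rintro _ ⟨z, hz, rfl⟩
      exact ⟨(hSsub hz).1, fun h => (hSsub hz).2 ((hseg z).1 h)⟩
    have h2 := (hS.image φ φ.continuous.continuousOn).subset_connectedComponentIn
      (mem_image_of_mem φ hyS) h1
    rwa [← connectedComponentIn_eq hyC] at h2

theorem reduce {ι : Type} (a b : ι → ℂ) (hab : ∀ i, a i ≠ b i)
    (hdisj : ∀ i j, i ≠ j → Disjoint (openSegment ℝ (a i) (b i)) (segment ℝ (a j) (b j)))
    {K : Set ℂ} (hKne : K.Nonempty) (hK : IsPreconnected K) (n : ℕ) :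
    ∀ A₀ : Set ℂ, IsOpen A₀ → SimplyConnectedSpace A₀ → K ⊆ A₀ →
    (∀ i, openSegment ℝ (a i) (b i) ⊆ A₀ ∨ Disjoint (openSegment ℝ (a i) (b i)) A₀) →
    {i | (openSegment ℝ (a i) (b i) ∩ A₀).Nonempty}.Finite →
    {i | (openSegment ℝ (a i) (b i) ∩ A₀).Nonempty}.ncard = n →
    ∃ A ⊆ A₀, IsOpen A ∧ SimplyConnectedSpace A ∧ K ⊆ A ∧
      ∀ i, Disjoint (segment ℝ (a i) (b i)) K →
        segment ℝ (a i) (b i) ⊆ A ∨ Disjoint (segment ℝ (a i) (b i)) A := by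
  induction n using Nat.strong_induction_on with
  | _ n ih =>
  intro A hAo hA hKA hgood hfin hn
  by_cases hdone : ∀ i, Disjoint (segment ℝ (a i) (b i)) K →
        segment ℝ (a i) (b i) ⊆ A ∨ Disjoint (segment ℝ (a i) (b i)) A
  · exact ⟨A, subset_rfl, hAo, hA, hKA, hdone⟩
  push Not at hdone
  obtain ⟨i, hiK, hi1, hi2⟩ := hdone
  set E := segment ℝ (a i) (b i) with hE
  have hEc : IsClosed E := by
    rw [hE, segment_eq_image']
    exact (isCompact_Icc.image (by fun_prop)).isClosed
  have hmeet : (openSegment ℝ (a i) (b i) ∩ A).Nonempty := by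
    obtain ⟨z, hz, hzA⟩ := not_disjoint_iff.1 hi2
    have : z ∈ closure (openSegment ℝ (a i) (b i)) := segment_subset_closure_openSegment hz
    obtain ⟨w, hw, hw'⟩ := mem_closure_iff.1 this A hAo hzA
    exact ⟨w, hw', hw⟩
  have hopen : openSegment ℝ (a i) (b i) ⊆ A := by
    rcases hgood i with h | h
    · exact h
    · exact absurd h (not_disjoint_iff_nonempty_inter.2 hmeet)
  obtain ⟨x, hx⟩ := hKne
  have hKsub : K ⊆ A \ E := fun k hk => ⟨hKA hk, fun h => disjoint_left.1 hiK h hk⟩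
  set C := connectedComponentIn (A \ E) x with hC
  have hCsc : SimplyConnectedSpace C := by
    by_cases hai : a i ∈ A
    · have hbi : b i ∉ A := by
        intro hbi
        apply hi1
        rw [hE, ← insert_endpoints_openSegment]
        rintro z (rfl | rfl | h)
        exacts [hai, hbi, hopen h]
      rw [hC, hE, segment_symm]
      exact sc_step hAo hA (hab i).symm hbi (by rwa [openSegment_symm])
        (by rw [segment_symm]; exact hKsub hx)
    · exact sc_step hAo hA (hab i) hai hopen (hKsub hx)
  have hCA : C ⊆ A \ E := connectedComponentIn_subset _ _
  have hCA' : C ⊆ A := hCA.trans sdiff_subset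
  have hsub : {j | (openSegment ℝ (a j) (b j) ∩ C).Nonempty} ⊂
      {j | (openSegment ℝ (a j) (b j) ∩ A).Nonempty} := by
    refine ⟨fun j hj => hj.mono (inter_subset_inter_right _ hCA'), fun h => ?_⟩
    obtain ⟨z, hz, hzC⟩ := h (show i ∈ _ from hmeet)
    exact (hCA hzC).2 (openSegment_subset_segment _ _ _ hz)
  have hlt := ncard_lt_ncard hsub hfin
  rw [hn] at hlt
  obtain ⟨A', hA'C, h1, h2, h3, h4⟩ := ih _ hlt C (hAo.sdiff hEc).connectedComponentIn hCsc
    (hK.subset_connectedComponentIn hx hKsub) (by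
      intro j
      by_cases hji : j = i
      · right
        rw [hji]
        exact disjoint_left.2 fun z hz hzC => (hCA hzC).2 (openSegment_subset_segment _ _ _ hz)
      · rcases hgood j with h | h
        · rw [or_iff_not_imp_right, not_disjoint_iff]
          rintro ⟨z, hz, hzC⟩
          have hs : openSegment ℝ (a j) (b j) ⊆ A \ E := fun w hw =>
            ⟨h hw, fun hwE => disjoint_left.1 (hdisj j i hji) hw hwE⟩
          have := (convex_openSegment (𝕜 := ℝ) (a j) (b j)).isPreconnected.subset_connectedComponentIn hz hs
          rwa [← connectedComponentIn_eq hzC] at this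
        · right; exact h.mono_right hCA')
    (hfin.subset hsub.subset) rfl
  exact ⟨A', hA'C.trans hCA', h1, h2, h3, h4⟩

/-- grid vertices -/
def gv (m n : ℤ) : ℂ := ⟨m, n⟩

def ga : ℤ × ℤ × Bool → ℂ := fun i => gv i.1 i.2.1
def gb : ℤ × ℤ × Bool → ℂ := fun i => if i.2.2 then gv (i.1 + 1) i.2.1 else gv i.1 (i.2.1 + 1)

theorem mem_seg_h (m n : ℤ) (z : ℂ) :
    z ∈ segment ℝ (ga (m, n, true)) (gb (m, n, true)) ↔ z.im = n ∧ (m : ℝ) ≤ z.re ∧ z.re ≤ m + 1 := by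
  rw [segment_eq_image']
  simp only [ga, gb, gv, if_true, mem_image, mem_Icc]
  constructor
  · rintro ⟨t, ⟨h0, h1⟩, rfl⟩
    simp
    exact ⟨h0, h1⟩
  · rintro ⟨h1, h2, h3⟩
    refine ⟨z.re - m, ⟨by linarith, by linarith⟩, ?_⟩
    apply Complex.ext <;> simp [h1]

theorem mem_seg_v (m n : ℤ) (z : ℂ) :
    z ∈ segment ℝ (ga (m, n, false)) (gb (m, n, false)) ↔ z.re = m ∧ (n : ℝ) ≤ z.im ∧ z.im ≤ n + 1 := by
  rw [segment_eq_image']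
  simp only [ga, gb, gv, mem_image, mem_Icc]
  constructor
  · rintro ⟨t, ⟨h0, h1⟩, rfl⟩
    simp
    exact ⟨h0, h1⟩
  · rintro ⟨h1, h2, h3⟩
    refine ⟨z.im - n, ⟨by linarith, by linarith⟩, ?_⟩
    apply Complex.ext <;> simp [h1]

theorem mem_oseg_h (m n : ℤ) (z : ℂ) :
    z ∈ openSegment ℝ (ga (m, n, true)) (gb (m, n, true)) ↔
      z.im = n ∧ (m : ℝ) < z.re ∧ z.re < m + 1 := by
  rw [openSegment_eq_image']
  simp only [ga, gb, gv, if_true, mem_image, mem_Ioo]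
  constructor
  · rintro ⟨t, ⟨h0, h1⟩, rfl⟩
    simp
    exact ⟨h0, h1⟩
  · rintro ⟨h1, h2, h3⟩
    refine ⟨z.re - m, ⟨by linarith, by linarith⟩, ?_⟩
    apply Complex.ext <;> simp [h1]

theorem mem_oseg_v (m n : ℤ) (z : ℂ) :
    z ∈ openSegment ℝ (ga (m, n, false)) (gb (m, n, false)) ↔
      z.re = m ∧ (n : ℝ) < z.im ∧ z.im < n + 1 := by
  rw [openSegment_eq_image']
  simp only [ga, gb, gv, mem_image, mem_Ioo]
  constructor
  · rintro ⟨t, ⟨h0, h1⟩, rfl⟩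
    simp
    exact ⟨h0, h1⟩
  · rintro ⟨h1, h2, h3⟩
    refine ⟨z.im - n, ⟨by linarith, by linarith⟩, ?_⟩
    apply Complex.ext <;> simp [h1]

theorem gab_ne (i : ℤ × ℤ × Bool) : ga i ≠ gb i := by
  obtain ⟨m, n, _ | _⟩ := i
  · intro h
    have := congrArg Complex.im h
    simp [ga, gb, gv] at this
  · intro h
    have := congrArg Complex.re h
    simp [ga, gb, gv] at this

theorem no_int_between {m n : ℤ} (h1 : (m : ℝ) < n) (h2 : (n : ℝ) < m + 1) : False := by
  have h1' : m < n := by exact_mod_cast h1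
  have h2' : n < m + 1 := by exact_mod_cast h2
  omega

theorem int_eq_of {m n : ℤ} {x : ℝ} (h1 : (m : ℝ) < x) (h2 : x < m + 1) (h3 : (n : ℝ) ≤ x)
    (h4 : x ≤ n + 1) : m = n := by
  have h1' : m < n + 1 := by exact_mod_cast lt_of_lt_of_le h1 h4
  have h2' : n < m + 1 := by exact_mod_cast lt_of_le_of_lt h3 h2
  omega

theorem grid_disj (i j : ℤ × ℤ × Bool) (hij : i ≠ j) :
    Disjoint (openSegment ℝ (ga i) (gb i)) (segment ℝ (ga j) (gb j)) := by
  rw [disjoint_left]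
  intro z hz hz'
  obtain ⟨m, n, _ | _⟩ := i <;> obtain ⟨p, q, _ | _⟩ := j
  · rw [mem_oseg_v] at hz
    rw [mem_seg_v] at hz'
    obtain ⟨h1, h2, h3⟩ := hz
    obtain ⟨h4, h5, h6⟩ := hz'
    have e1 := int_eq_of h2 h3 h5 h6
    have e2 : m = p := by rw [h1] at h4; exact_mod_cast h4
    exact hij (by rw [e1, e2])
  · rw [mem_oseg_v] at hz
    rw [mem_seg_h] at hz'
    obtain ⟨h1, h2, h3⟩ := hz
    rw [hz'.1] at h2 h3
    exact no_int_between h2 h3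
  · rw [mem_oseg_h] at hz
    rw [mem_seg_v] at hz'
    obtain ⟨h1, h2, h3⟩ := hz
    rw [hz'.1] at h2 h3
    exact no_int_between h2 h3
  · rw [mem_oseg_h] at hz
    rw [mem_seg_h] at hz'
    obtain ⟨h1, h2, h3⟩ := hz
    obtain ⟨h4, h5, h6⟩ := hz'
    have e1 := int_eq_of h2 h3 h5 h6
    have e2 : n = q := by rw [h1] at h4; exact_mod_cast h4
    exact hij (by rw [e1, e2])

def box (N : ℕ) : Set ℂ := {z | (-N < z.re ∧ z.re < N) ∧ (-N < z.im ∧ z.im < N)}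

theorem box_eq (N : ℕ) : box N = Ioo (-(N:ℝ)) N ×ℂ Ioo (-(N:ℝ)) N := rfl

theorem box_open (N : ℕ) : IsOpen (box N) := by
  rw [box_eq]; exact isOpen_Ioo.reProdIm isOpen_Ioo

theorem box_convex (N : ℕ) : Convex ℝ (box N) := by
  
  exact ((convex_Ioo (-(N:ℝ)) N).linear_preimage Complex.reLm).inter
    ((convex_Ioo (-(N:ℝ)) N).linear_preimage Complex.imLm)

theorem int_box {N : ℕ} {m : ℤ} {x : ℝ} (h1 : (m : ℝ) < x) (h2 : x < m + 1) (h3 : -(N:ℝ) < x)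
    (h4 : x < N) : -(N:ℤ) ≤ m ∧ m + 1 ≤ N := by
  have h1' : m < (N:ℤ) := by
    have := h1.trans h4
    exact_mod_cast this
  have h2' : -(N:ℤ) < m + 1 := by
    have := h3.trans h2
    exact_mod_cast this
  omega

theorem grid_good (N : ℕ) (i : ℤ × ℤ × Bool) :
    openSegment ℝ (ga i) (gb i) ⊆ box N ∨ Disjoint (openSegment ℝ (ga i) (gb i)) (box N) := by
  rw [or_iff_not_imp_right, not_disjoint_iff]
  rintro ⟨z, hz, ⟨b1, b2⟩, b3, b4⟩ w hw
  obtain ⟨m, n, _ | _⟩ := i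
  · rw [mem_oseg_v] at hz hw
    obtain ⟨h1, h2, h3⟩ := hz
    obtain ⟨h4, h5, h6⟩ := hw
    obtain ⟨c1, c2⟩ := int_box h2 h3 b3 b4
    have c1' : -(N:ℝ) ≤ n := by exact_mod_cast c1
    have c2' : (n:ℝ) + 1 ≤ N := by exact_mod_cast c2
    refine ⟨⟨?_, ?_⟩, ?_, ?_⟩ <;> linarith
  · rw [mem_oseg_h] at hz hw
    obtain ⟨h1, h2, h3⟩ := hz
    obtain ⟨h4, h5, h6⟩ := hw
    obtain ⟨c1, c2⟩ := int_box h2 h3 b1 b2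
    have c1' : -(N:ℝ) ≤ m := by exact_mod_cast c1
    have c2' : (m:ℝ) + 1 ≤ N := by exact_mod_cast c2
    refine ⟨⟨?_, ?_⟩, ?_, ?_⟩ <;> linarith

theorem grid_fin (N : ℕ) : {i | (openSegment ℝ (ga i) (gb i) ∩ box N).Nonempty}.Finite := by
  apply ((finite_Icc (-(N:ℤ)) N).prod ((finite_Icc (-(N:ℤ)) N).prod (finite_univ (α := Bool)))).subset
  rintro ⟨m, n, _ | _⟩ ⟨z, hz, ⟨b1, b2⟩, b3, b4⟩
  · rw [mem_oseg_v] at hz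
    obtain ⟨h1, h2, h3⟩ := hz
    obtain ⟨c1, c2⟩ := int_box h2 h3 b3 b4
    rw [h1] at b1 b2
    have b1' : -(N:ℤ) < m := by exact_mod_cast b1
    have b2' : m < (N:ℤ) := by exact_mod_cast b2
    exact ⟨⟨b1'.le, b2'.le⟩, ⟨c1, by dsimp only; omega⟩, mem_univ _⟩
  · rw [mem_oseg_h] at hz
    obtain ⟨h1, h2, h3⟩ := hz
    obtain ⟨c1, c2⟩ := int_box h2 h3 b1 b2
    rw [h1] at b3 b4
    have b1' : -(N:ℤ) < n := by exact_mod_cast b3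
    have b2' : n < (N:ℤ) := by exact_mod_cast b4
    exact ⟨⟨c1, by dsimp only; omega⟩, ⟨b1'.le, b2'.le⟩, mem_univ _⟩

theorem dist_le_re_im (z w : ℂ) : dist z w ≤ |z.re - w.re| + |z.im - w.im| := by
  rw [dist_eq_norm]
  simpa using Complex.norm_le_abs_re_add_abs_im (z - w)

theorem unit_case {K U : Set ℂ} (hKne : K.Nonempty) (hK : IsPreconnected K) (N : ℕ)
    (hKN : K ⊆ box N)
    (hL : ∀ z ∈ box N, z ∉ U → ∃ L : Set ℂ, IsPreconnected L ∧ z ∈ L ∧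
      (∃ w ∈ L, (N:ℝ) ≤ w.re) ∧ ∀ y ∈ L, ∀ k ∈ K, 5 < dist y k) :
    ∃ V : Set ℂ, IsOpen V ∧ K ⊆ V ∧ V ⊆ U ∧ SimplyConnectedSpace V := by
  obtain ⟨x, hx⟩ := hKne
  have hbsc : SimplyConnectedSpace (box N) := by
    have := (box_convex N).contractibleSpace ⟨x, hKN hx⟩
    infer_instance
  obtain ⟨A, hAb, hAo, hAsc, hKA, hA⟩ := reduce ga gb gab_ne grid_disj ⟨x, hx⟩ hK _ (box N)
    (box_open N) hbsc hKN (grid_good N) (grid_fin N) rfl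
  have hApre : IsPreconnected A := by
    rw [isPreconnected_iff_preconnectedSpace]
    infer_instance
  refine ⟨A, hAo, hKA, ?_, hAsc⟩
  intro z hzA
  by_contra hzU
  obtain ⟨L, hLp, hzL, ⟨w, hwL, hw⟩, hLd⟩ := hL z (hAb hzA) hzU
  -- edges near L
  have edge : ∀ y ∈ L, ∀ m n : ℤ, ∀ b : Bool, |y.re - m| ≤ 2 → |y.im - n| ≤ 2 →
      segment ℝ (ga (m, n, b)) (gb (m, n, b)) ⊆ A ∨
        Disjoint (segment ℝ (ga (m, n, b)) (gb (m, n, b))) A := by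
    intro y hy m n b h1 h2
    apply hA
    rw [disjoint_left]
    intro k hk hkK
    have h3 := hLd y hy k hkK
    have h4 := dist_le_re_im y k
    rw [abs_le] at h1 h2
    have h5 : |y.re - k.re| + |y.im - k.im| ≤ 5 := by
      cases b
      · rw [mem_seg_v] at hk
        obtain ⟨e1, e2, e3⟩ := hk
        have : |y.re - k.re| ≤ 2 := by rw [abs_le]; constructor <;> linarith
        have : |y.im - k.im| ≤ 3 := by rw [abs_le]; constructor <;> linarith
        linarith
      · rw [mem_seg_h] at hk
        obtain ⟨e1, e2, e3⟩ := hk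
        have : |y.re - k.re| ≤ 3 := by rw [abs_le]; constructor <;> linarith
        have : |y.im - k.im| ≤ 2 := by rw [abs_le]; constructor <;> linarith
        linarith
    linarith
  have edgeh : ∀ y ∈ L, ∀ m n : ℤ, |y.re - m| ≤ 2 → |y.im - n| ≤ 2 →
      (gv m n ∈ A ↔ gv (m + 1) n ∈ A) := by
    intro y hy m n h1 h2
    have i1 := left_mem_segment ℝ (ga (m, n, true)) (gb (m, n, true))
    have i2 := right_mem_segment ℝ (ga (m, n, true)) (gb (m, n, true))
    rcases edge y hy m n true h1 h2 with h | h
    · exact ⟨fun _ => h i2, fun _ => h i1⟩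
    · exact ⟨fun h' => (disjoint_left.1 h i1 h').elim, fun h' => (disjoint_left.1 h i2 h').elim⟩
  have edgev : ∀ y ∈ L, ∀ m n : ℤ, |y.re - m| ≤ 2 → |y.im - n| ≤ 2 →
      (gv m n ∈ A ↔ gv m (n + 1) ∈ A) := by
    intro y hy m n h1 h2
    have i1 := left_mem_segment ℝ (ga (m, n, false)) (gb (m, n, false))
    have i2 := right_mem_segment ℝ (ga (m, n, false)) (gb (m, n, false))
    rcases edge y hy m n false h1 h2 with h | h
    · exact ⟨fun _ => h i2, fun _ => h i1⟩
    · exact ⟨fun h' => (disjoint_left.1 h i1 h').elim, fun h' => (disjoint_left.1 h i2 h').elim⟩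
  have step : ∀ y ∈ L, ∀ y' : ℂ, dist y' y < 1 →
      (gv ⌊y.re⌋ ⌊y.im⌋ ∈ A ↔ gv ⌊y'.re⌋ ⌊y'.im⌋ ∈ A) := by
    intro y hy y' hd
    rw [dist_eq_norm] at hd
    have d1 := (Complex.abs_re_le_norm (y' - y)).trans_lt hd
    have d2 := (Complex.abs_im_le_norm (y' - y)).trans_lt hd
    rw [Complex.sub_re, abs_lt] at d1
    rw [Complex.sub_im, abs_lt] at d2
    have a1 := Int.floor_le y.re
    have a2 := Int.lt_floor_add_one y.re
    have a3 := Int.floor_le y.im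
    have a4 := Int.lt_floor_add_one y.im
    have a5 := Int.floor_le y'.re
    have a6 := Int.lt_floor_add_one y'.re
    have a7 := Int.floor_le y'.im
    have a8 := Int.lt_floor_add_one y'.im
    generalize ⌊y.re⌋ = p at *
    generalize ⌊y.im⌋ = q at *
    generalize ⌊y'.re⌋ = p' at *
    generalize ⌊y'.im⌋ = q' at *
    have b1 : p < p' + 2 := by
      have : (p:ℝ) < p' + 2 := by linarith
      exact_mod_cast this
    have b2 : p' < p + 2 := by
      have : (p':ℝ) < p + 2 := by linarith
      exact_mod_cast this
    have b3 : q < q' + 2 := by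
      have : (q:ℝ) < q' + 2 := by linarith
      exact_mod_cast this
    have b4 : q' < q + 2 := by
      have : (q':ℝ) < q + 2 := by linarith
      exact_mod_cast this
    have hp : p' = p ∨ p' = p + 1 ∨ p = p' + 1 := by omega
    have hq : q' = q ∨ q' = q + 1 ∨ q = q' + 1 := by omega
    have s1 : gv p q ∈ A ↔ gv p' q ∈ A := by
      rcases hp with rfl | rfl | rfl
      · rfl
      · apply edgeh y hy <;> rw [abs_le] <;> constructor <;> linarith
      · push_cast at *
        symm
        apply edgeh y hy <;> rw [abs_le] <;> constructor <;> linarith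
    have s2 : gv p' q ∈ A ↔ gv p' q' ∈ A := by
      rcases hq with rfl | rfl | rfl
      · rfl
      · apply edgev y hy <;> rw [abs_le] <;> constructor <;> linarith
      · push_cast at *
        symm
        apply edgev y hy <;> rw [abs_le] <;> constructor <;> linarith
    exact s1.trans s2
  have hconst : gv ⌊z.re⌋ ⌊z.im⌋ ∈ A → gv ⌊w.re⌋ ⌊w.im⌋ ∈ A := by
    intro hz
    by_contra hw'
    obtain ⟨y, hy, hy1, hy2⟩ := hLp
      (⋃ y ∈ {y ∈ L | gv ⌊y.re⌋ ⌊y.im⌋ ∈ A}, Metric.ball y (1/2))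
      (⋃ y ∈ {y ∈ L | gv ⌊y.re⌋ ⌊y.im⌋ ∉ A}, Metric.ball y (1/2))
      (isOpen_biUnion fun _ _ => Metric.isOpen_ball) (isOpen_biUnion fun _ _ => Metric.isOpen_ball)
      (fun y hy => by
        by_cases h : gv ⌊y.re⌋ ⌊y.im⌋ ∈ A
        · exact Or.inl (mem_biUnion (show y ∈ {y ∈ L | gv ⌊y.re⌋ ⌊y.im⌋ ∈ A} from ⟨hy, h⟩)
            (Metric.mem_ball_self (by norm_num)))
        · exact Or.inr (mem_biUnion (show y ∈ {y ∈ L | gv ⌊y.re⌋ ⌊y.im⌋ ∉ A} from ⟨hy, h⟩)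
            (Metric.mem_ball_self (by norm_num))))
      ⟨z, hzL, mem_biUnion (show z ∈ {y ∈ L | gv ⌊y.re⌋ ⌊y.im⌋ ∈ A} from ⟨hzL, hz⟩)
            (Metric.mem_ball_self (by norm_num))⟩
      ⟨w, hwL, mem_biUnion (show w ∈ {y ∈ L | gv ⌊y.re⌋ ⌊y.im⌋ ∉ A} from ⟨hwL, hw'⟩)
            (Metric.mem_ball_self (by norm_num))⟩
    simp only [mem_iUnion] at hy1 hy2
    obtain ⟨u, ⟨hu, hu'⟩, hyu⟩ := hy1
    obtain ⟨v, ⟨hv, hv'⟩, hyv⟩ := hy2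
    rw [Metric.mem_ball] at hyu hyv
    exact hv' ((step v hv y (by linarith)).2 ((step u hu y (by linarith)).1 hu'))
  have hwA : gv ⌊w.re⌋ ⌊w.im⌋ ∉ A := by
    intro h
    have h1 := (hAb h).1.2
    have h2 : (N:ℤ) ≤ ⌊w.re⌋ := Int.le_floor.2 (by exact_mod_cast hw)
    have h3 : ((N:ℤ):ℝ) ≤ (⌊w.re⌋:ℝ) := by exact_mod_cast h2
    simp only [gv] at h1
    push_cast at h3
    linarith
  apply hwA
  apply hconst
  have a1 := Int.floor_le z.re
  have a2 := Int.lt_floor_add_one z.re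
  have a3 := Int.floor_le z.im
  have a4 := Int.lt_floor_add_one z.im
  generalize ⌊z.re⌋ = p at *
  generalize ⌊z.im⌋ = q at *
  have v1 := edgeh z hzL p q (by rw [abs_le]; constructor <;> linarith)
    (by rw [abs_le]; constructor <;> linarith)
  have v2 := edgev z hzL p q (by rw [abs_le]; constructor <;> linarith)
    (by rw [abs_le]; constructor <;> linarith)
  have e1 := edge z hzL p q true (by rw [abs_le]; constructor <;> linarith)
    (by rw [abs_le]; constructor <;> linarith)
  have e2 := edge z hzL p q false (by rw [abs_le]; constructor <;> linarith)
    (by rw [abs_le]; constructor <;> linarith)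
  have e3 := edge z hzL p (q + 1) true (by rw [abs_le]; constructor <;> linarith)
    (by rw [abs_le]; push_cast; constructor <;> linarith)
  have e4 := edge z hzL (p + 1) q false (by rw [abs_le]; push_cast; constructor <;> linarith)
    (by rw [abs_le]; constructor <;> linarith)
  rcases e1 with e1 | e1
  · exact e1 (left_mem_segment ℝ _ _)
  rcases e2 with e2 | e2
  · exact e2 (left_mem_segment ℝ _ _)
  rcases e3 with e3 | e3
  · exact v2.2 (e3 (left_mem_segment ℝ _ _))
  rcases e4 with e4 | e4
  · exact v1.2 (e4 (left_mem_segment ℝ _ _))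
  exfalso
  have hintg : ∀ y ∈ A, (p:ℝ) ≤ y.re → y.re ≤ p + 1 → (q:ℝ) ≤ y.im → y.im ≤ q + 1 →
      y ∈ Ioo (p:ℝ) (p + 1) ×ℂ Ioo (q:ℝ) (q + 1) := by
    intro y hy c1 c2 c3 c4
    have d1 : y.im ≠ q := fun h => disjoint_left.1 e1 ((mem_seg_h _ _ _).2 ⟨h, c1, c2⟩) hy
    have d2 : y.re ≠ p := fun h => disjoint_left.1 e2 ((mem_seg_v _ _ _).2 ⟨h, c3, c4⟩) hy
    have d3 : y.im ≠ q + 1 := fun h => disjoint_left.1 e3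
      ((mem_seg_h _ _ _).2 ⟨by rw [h]; push_cast; rfl, c1, c2⟩) hy
    have d4 : y.re ≠ p + 1 := fun h => disjoint_left.1 e4
      ((mem_seg_v _ _ _).2 ⟨by rw [h]; push_cast; rfl, c3, c4⟩) hy
    exact ⟨⟨lt_of_le_of_ne c1 d2.symm, lt_of_le_of_ne c2 d4⟩,
      ⟨lt_of_le_of_ne c3 d1.symm, lt_of_le_of_ne c4 d3⟩⟩
  have hzi := hintg z hzA a1 a2.le a3 a4.le
  have hcl : IsClosed (Icc (p:ℝ) (p + 1) ×ℂ Icc (q:ℝ) (q + 1)) := isClosed_Icc.reProdIm isClosed_Icc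
  have hsub := hApre.subset_left_of_subset_union
    ((isOpen_Ioo (a := (p:ℝ)) (b := p + 1)).reProdIm (isOpen_Ioo (a := (q:ℝ)) (b := q + 1)))
    hcl.isOpen_compl
    (disjoint_left.2 fun y hy hy' => hy' ⟨Ioo_subset_Icc_self hy.1, Ioo_subset_Icc_self hy.2⟩)
    (fun y hy => by
      by_cases h : y ∈ Icc (p:ℝ) (p + 1) ×ℂ Icc (q:ℝ) (q + 1)
      · exact Or.inl (hintg y hy h.1.1 h.1.2 h.2.1 h.2.2)
      · exact Or.inr h) ⟨z, hzA, hzi⟩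
  obtain ⟨⟨x1, x2⟩, x3, x4⟩ := hsub (hKA hx)
  have h3 := hLd z hzL x hx
  have h4 := dist_le_re_im z x
  have : |z.re - x.re| ≤ 1 := by rw [abs_le]; constructor <;> linarith
  have : |z.im - x.im| ≤ 1 := by rw [abs_le]; constructor <;> linarith
  linarith

theorem unif_join {K : Set ℂ} (hKc : IsClosed K) (hfull : IsConnected Kᶜ) {w : ℂ} (hw : w ∉ K)
    {M : Set ℂ} (hM : IsCompact M) (hMK : Disjoint M K) :
    ∃ ε > 0, ∀ z ∈ M, ∃ L : Set ℂ, IsPreconnected L ∧ z ∈ L ∧ w ∈ L ∧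
      ∀ y ∈ L, ∀ k ∈ K, ε < dist y k := by
  refine hM.induction_on (p := fun S => ∃ ε > 0, ∀ z ∈ S, ∃ L : Set ℂ, IsPreconnected L ∧ z ∈ L ∧
    w ∈ L ∧ ∀ y ∈ L, ∀ k ∈ K, ε < dist y k) ?_ ?_ ?_ ?_
  · exact ⟨1, one_pos, fun z hz => hz.elim⟩
  · rintro S T hST ⟨ε, hε, h⟩
    exact ⟨ε, hε, fun z hz => h z (hST hz)⟩
  · rintro S T ⟨ε, hε, h⟩ ⟨ε', hε', h'⟩
    refine ⟨min ε ε', lt_min hε hε', ?_⟩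
    rintro z (hz | hz)
    · obtain ⟨L, h1, h2, h3, h4⟩ := h z hz
      exact ⟨L, h1, h2, h3, fun y hy k hk => (min_le_left _ _).trans_lt (h4 y hy k hk)⟩
    · obtain ⟨L, h1, h2, h3, h4⟩ := h' z hz
      exact ⟨L, h1, h2, h3, fun y hy k hk => (min_le_right _ _).trans_lt (h4 y hy k hk)⟩
  · intro z hz
    have hzK : z ∈ Kᶜ := fun h => disjoint_left.1 hMK hz h
    have hpc := hKc.isOpen_compl.isConnected_iff_isPathConnected.1 hfull
    obtain ⟨γ, hγ⟩ := hpc.joinedIn z hzK w hw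
    obtain ⟨r, hr, hrK⟩ := Metric.nhds_basis_closedBall.mem_iff.1 (hKc.isOpen_compl.mem_nhds hzK)
    have hLc : IsCompact (Metric.closedBall z r ∪ range γ) :=
      (isCompact_closedBall z r).union (isCompact_range γ.continuous)
    have hLsub : Metric.closedBall z r ∪ range γ ⊆ Kᶜ := by
      rintro y (hy | ⟨t, rfl⟩)
      · exact hrK hy
      · exact hγ t
    obtain ⟨δ, hδ, hδK⟩ := hLc.exists_thickening_subset_open hKc.isOpen_compl hLsub
    refine ⟨Metric.closedBall z r, mem_nhdsWithin_of_mem_nhds (Metric.closedBall_mem_nhds z hr),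
      δ / 2, by positivity, fun u hu => ⟨Metric.closedBall z r ∪ range γ, ?_, Or.inl hu,
        Or.inr ⟨1, γ.target⟩, ?_⟩⟩
    · exact IsPreconnected.union z (Metric.mem_closedBall_self hr.le) ⟨0, γ.source⟩
        (convex_closedBall z r).isPreconnected (isPreconnected_range γ.continuous)
    · intro y hy k hk
      by_contra hlt
      exact hδK (Metric.mem_thickening_iff.2 ⟨y, hy, by rw [dist_comm]; linarith⟩) hk

end Helpers

/-- A nonempty compact connected full subset `K` of `ℂ` (full meaning that `ℂ \ K` is
connected) has a neighborhood basis of connected, simply connected open sets: every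
open set `U ⊇ K` contains a connected and simply connected open set `V` with
`K ⊆ V ⊆ U`. -/
theorem full_continuum_has_simply_connected_nbhd_basis (K : Set ℂ)
    (hKne : K.Nonempty) (hKcomp : IsCompact K) (hKconn : IsConnected K)
    (hfull : IsConnected Kᶜ) :
    ∀ U : Set ℂ, IsOpen U → K ⊆ U →
      ∃ V : Set ℂ, IsOpen V ∧ K ⊆ V ∧ V ⊆ U ∧ IsConnected V ∧
        SimplyConnectedSpace V := by
  intro U hU hKU
  obtain ⟨C, hC⟩ := hKcomp.isBounded.exists_norm_le
  obtain ⟨R, hR⟩ := exists_nat_gt C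
  have hKR : K ⊆ box R := by
    intro k hk
    have h1 := (Complex.abs_re_le_norm k).trans_lt ((hC k hk).trans_lt hR)
    have h2 := (Complex.abs_im_le_norm k).trans_lt ((hC k hk).trans_lt hR)
    exact ⟨abs_lt.1 h1, abs_lt.1 h2⟩
  have hw : (R:ℂ) ∉ K := fun h => by
    have := (hKR h).1.2
    simp at this
  have hM : IsCompact ((Set.Icc (-(R:ℝ)) R ×ℂ Set.Icc (-(R:ℝ)) R) \ U) :=
    (isCompact_Icc.reProdIm isCompact_Icc).diff hU
  obtain ⟨ε, hε, hL⟩ := unif_join hKcomp.isClosed hfull hw hM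
    (Set.disjoint_left.2 fun z hz hzK => hz.2 (hKU hzK))
  obtain ⟨n, hn⟩ := exists_nat_gt (5 / ε)
  have hn0 : (0:ℝ) < n := lt_trans (by positivity) hn
  have hn5 : 5 < n * ε := by rwa [div_lt_iff₀ hε] at hn
  have hnc : (n:ℂ) ≠ 0 := by
    have : (n:ℝ) ≠ 0 := hn0.ne'
    exact_mod_cast this
  let φ : ℂ ≃ₜ ℂ := Homeomorph.mulLeft₀ (n:ℂ) hnc
  have hφ : ∀ z, φ z = n * z := fun z => rfl
  have hre : ∀ z, (φ z).re = n * z.re := fun z => by simp [hφ]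
  have him : ∀ z, (φ z).im = n * z.im := fun z => by simp [hφ]
  have hbox : ∀ z, φ z ∈ box (n * R) ↔ z ∈ box R := by
    intro z
    simp only [box, Set.mem_ofPred_eq, hre, him]
    push_cast
    rw [← mul_neg]
    simp only [mul_lt_mul_iff_right₀ hn0]
  obtain ⟨V, hVo, hKV, hVU, hVsc⟩ := unit_case (K := φ '' K) (U := φ '' U) (hKne.image _)
    (hKconn.isPreconnected.image _ φ.continuous.continuousOn) (n * R)
    (by rintro _ ⟨k, hk, rfl⟩; exact (hbox k).2 (hKR hk)) (by
      intro z' hz' hzU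
      obtain ⟨z, rfl⟩ := φ.surjective z'
      have hz := (hbox z).1 hz'
      obtain ⟨L, h1, h2, h3, h4⟩ := hL z ⟨⟨⟨hz.1.1.le, hz.1.2.le⟩, ⟨hz.2.1.le, hz.2.2.le⟩⟩,
        fun h => hzU ⟨z, h, rfl⟩⟩
      refine ⟨φ '' L, h1.image _ φ.continuous.continuousOn, ⟨z, h2, rfl⟩,
        ⟨φ R, ⟨_, h3, rfl⟩, ?_⟩, ?_⟩
      · rw [hre]; push_cast; simp
      · rintro _ ⟨y, hy, rfl⟩ _ ⟨k, hk, rfl⟩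
        have := h4 y hy k hk
        rw [dist_eq_norm, hφ, hφ, ← mul_sub, norm_mul, Complex.norm_natCast, ← dist_eq_norm]
        exact hn5.trans (mul_lt_mul_of_pos_left this hn0))
  have hsc : IsSimplyConnected (φ ⁻¹' V) := φ.isSimplyConnected_preimage.2 hVsc
  refine ⟨φ ⁻¹' V, hVo.preimage φ.continuous, fun k hk => hKV ⟨k, hk, rfl⟩, ?_,
    hsc.isPathConnected.isConnected, hsc.simplyConnectedSpace⟩
  intro z hz
  obtain ⟨u, hu, h⟩ := hVU hz
  rwa [← φ.injective h]
end
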